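/- Let k be a finite field with q elements and let C be a skeletally small, idempotent-complete, k-linear triangulated category with shift functor T in which all Hom-spaces are finite, and suppose C is 2-periodic, i.e. T² ≅ Id. Then for all indecomposable objects X, Y, Z of C, q − 1 divides the integer d(X)·(F_{XY}^{TZ} − F_{YX}^{TZ}) − d(Z)·(F_{YZ}^{TX} − F_{ZY}^{TX}). (This is the invariance property of the symmetric bilinear form on the Hall Lie algebra.) -/

import Mathlib

open CategoryTheory CategoryTheory.Limits CategoryTheory.Pretriangulated

universe w v u

namespace HallTri

/-- The Jacobson radical of a `k`-algebra `A`, as a `k`-submodule of `A`. -/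
def radSubmodule (k : Type) [Field k] (A : Type w) [Ring A] [Algebra k A] :
    Submodule k A where
  carrier := {x | x ∈ TwoSidedIdeal.jacobson (⊥ : TwoSidedIdeal A)}
  add_mem' := by
    intro a b ha hb
    show a + b ∈ TwoSidedIdeal.jacobson (⊥ : TwoSidedIdeal A)
    exact add_mem ha hb
  zero_mem' := by
    show (0 : A) ∈ TwoSidedIdeal.jacobson (⊥ : TwoSidedIdeal A)
    exact zero_mem _
  smul_mem' := by
    intro a x hx
    show a • x ∈ TwoSidedIdeal.jacobson (⊥ : TwoSidedIdeal A)
    rw [Algebra.smul_def]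
    exact TwoSidedIdeal.mul_mem_left _ _ _ hx

/-- `dk k A` is the `k`-dimension of `A / rad A`, for a `k`-algebra `A`. -/
noncomputable def dk (k : Type) [Field k] (A : Type w) [Ring A] [Algebra k A] : ℕ :=
  Module.finrank k (A ⧸ radSubmodule k A)

variable (k : Type) [Field k] [Fintype k]
variable {C : Type u} [Category.{v} C] [HasZeroObject C] [HasShift C ℤ] [Preadditive C]
  [∀ n : ℤ, (shiftFunctor C n).Additive] [Pretriangulated C] [IsTriangulated C]
  [Linear k C] [IsIdempotentComplete C] [HasBinaryBiproducts C]

/-- `WT X Y L` : the set of distinguished triangles `Y → L → X → TY`. -/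
def WT (X Y L : C) : Type v :=
  {t : (Y ⟶ L) × (L ⟶ X) × (X ⟶ Y⟦(1 : ℤ)⟧) //
    Triangle.mk t.1 t.2.1 t.2.2 ∈ distTriang C}

/-- Orbit relation for the action of `Aut X × Aut Y` on `WT X Y L`:
`(ξ, η) • (f, g, h) = (f∘η⁻¹, ξ∘g, (Tη)∘h∘ξ⁻¹)`. -/
def WTRel (X Y L : C) (p q : WT X Y L) : Prop :=
  ∃ (ξ : Aut X) (η : Aut Y),
    q.1.1 = η.inv ≫ p.1.1 ∧
    q.1.2.1 = p.1.2.1 ≫ ξ.hom ∧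
    q.1.2.2 = ξ.inv ≫ p.1.2.2 ≫ (shiftFunctor C (1 : ℤ)).map η.hom

/-- The triangulated Hall number `F_{XY}^L`, the number of orbits of `Aut X × Aut Y`
on `WT X Y L`. -/
noncomputable def FT (X Y L : C) : ℕ :=
  Nat.card (Quot (WTRel X Y L))

section Algebra

/-- A nontrivial ring whose only idempotents are `0` and `1`. -/
def TI (R : Type*) [Ring R] : Prop :=
  (0 : R) ≠ 1 ∧ ∀ x : R, x * x = x → x = 0 ∨ x = 1

theorem exists_pow_idem {R : Type*} [Monoid R] [Finite R] (x : R) :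
    ∃ n : ℕ, 0 < n ∧ x ^ n * x ^ n = x ^ n := by
  obtain ⟨a, b, hab, h⟩ := Finite.exists_ne_map_eq_of_infinite (fun n : ℕ => x ^ n)
  wlog hlt : a < b generalizing a b
  · exact this b a hab.symm h.symm (by omega)
  obtain ⟨d, rfl⟩ := Nat.exists_eq_add_of_lt hlt
  have key : ∀ j m : ℕ, x ^ (a + m + j * (d + 1)) = x ^ (a + m) := by
    intro j
    induction j with
    | zero => intro m; simp
    | succ j ih =>
      intro m
      have : a + m + (j + 1) * (d + 1) = (a + d + 1) + (m + j * (d + 1)) := by ring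
      rw [this, pow_add, ← h, ← pow_add, ← add_assoc, ih]
  refine ⟨(a + 1) * (d + 1), by positivity, ?_⟩
  rw [← pow_add]
  have e : (a + 1) * (d + 1) = a + ((a + 1) * (d + 1) - a) := by
    have : a ≤ (a + 1) * (d + 1) := by nlinarith
    omega
  have := key (a + 1) ((a + 1) * (d + 1) - a)
  rw [← e] at this
  exact this

variable {R : Type*} [Ring R] [Finite R]

theorem TI.unit_or_nil (h : TI R) (x : R) : IsUnit x ∨ IsNilpotent x := by
  obtain ⟨n, hn, hx⟩ := exists_pow_idem x
  rcases h.2 _ hx with h0 | h1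
  · exact Or.inr ⟨n, h0⟩
  · exact Or.inl (IsUnit.of_pow_eq_one h1 hn.ne')

theorem TI.not_unit_of_nil (h : TI R) {x : R} (hx : IsNilpotent x) : ¬ IsUnit x := by
  have : Nontrivial R := ⟨⟨0, 1, h.1⟩⟩
  intro hu
  obtain ⟨n, hn⟩ := hx
  have := hu.pow n
  rw [hn] at this
  exact not_isUnit_zero this

theorem TI.nil_of_not_unit (h : TI R) {x : R} (hx : ¬ IsUnit x) : IsNilpotent x :=
  (h.unit_or_nil x).resolve_left hx

theorem unit_of_mul_left {R : Type*} [Ring R] [Finite R] {r a : R} (h : IsUnit (r * a)) :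
    IsUnit a := by
  obtain ⟨u, hu⟩ := h
  have h1 : (↑u⁻¹ * r) * a = 1 := by rw [mul_assoc, ← hu]; simp
  have h2 : a * (↑u⁻¹ * r) = 1 := mul_eq_one_symm h1
  exact ⟨⟨a, _, h2, h1⟩, rfl⟩

/-- The left ideal of nonunits. -/
def NU (h : TI R) : Ideal R where
  carrier := {x | ¬ IsUnit x}
  zero_mem' := by
    have : Nontrivial R := ⟨⟨0, 1, h.1⟩⟩
    exact not_isUnit_zero
  add_mem' := by
    rintro a b ha hb ⟨u, hu⟩
    have hua : ¬ IsUnit (↑u⁻¹ * a) := fun h' => ha (unit_of_mul_left h')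
    have h1 : IsUnit (1 - ↑u⁻¹ * a) := (h.nil_of_not_unit hua).isUnit_one_sub
    have h2 : 1 - ↑u⁻¹ * a = ↑u⁻¹ * b := by
      have : (↑u⁻¹ : R) * (a + b) = 1 := by rw [← hu]; simp
      rw [← this]; noncomm_ring
    rw [h2] at h1
    exact hb (unit_of_mul_left h1)
  smul_mem' := by
    intro r a ha h'
    exact ha (unit_of_mul_left h')

theorem mem_NU (h : TI R) {x : R} : x ∈ NU h ↔ ¬ IsUnit x := Iff.rfl

theorem card_units_add (h : TI R) : Nat.card Rˣ + Nat.card (NU h) = Nat.card R := by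
  classical
  have e : Nat.card Rˣ = Nat.card {x : R // IsUnit x} :=
    Nat.card_congr (Equiv.ofBijective (fun u : Rˣ => (⟨u, u.isUnit⟩ : {x : R // IsUnit x}))
      ⟨fun a b hab => Units.ext (congrArg Subtype.val hab),
        fun ⟨x, hx⟩ => ⟨hx.unit, rfl⟩⟩)
  have e2 : Nat.card (NU h) = Nat.card {x : R // ¬ IsUnit x} := rfl
  rw [e, e2, ← Nat.card_sum]
  exact Nat.card_congr (Equiv.sumCompl _)

/-- residue cardinality -/
noncomputable def rc (h : TI R) : ℕ := Nat.card (R ⧸ NU h)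

theorem rc_mul (h : TI R) : Nat.card R = rc h * Nat.card (NU h) := by
  rw [rc, mul_comm]; exact Submodule.card_eq_card_quotient_mul_card (NU h)

theorem two_le_rc (h : TI R) : 2 ≤ rc h := by
  have : Nontrivial (R ⧸ NU h) := by
    apply Submodule.Quotient.nontrivial_iff.mpr
    intro ht
    have : (1 : R) ∈ NU h := by rw [ht]; trivial
    exact this isUnit_one
  have : Finite (R ⧸ NU h) := Finite.of_surjective _ (Submodule.mkQ_surjective _)
  exact Finite.one_lt_card

theorem card_units (h : TI R) : Nat.card Rˣ = (rc h - 1) * Nat.card (NU h) := by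
  have h1 := card_units_add h
  rw [rc_mul h] at h1
  rw [Nat.sub_mul, one_mul]
  omega

theorem card_module (h : TI R) : ∀ (n : ℕ) (M : Type w) [AddCommGroup M] [Module R M] [Finite M],
    Nat.card M = n → ∃ m, Nat.card M = rc h ^ m := by
  intro n
  induction n using Nat.strong_induction_on with
  | _ n ih =>
    intro M _ _ _ hn
    rcases subsingleton_or_nontrivial M with hs | hnt
    · exact ⟨0, by simp⟩
    · obtain ⟨N, hN⟩ := IsAtomic.exists_atom (Submodule R M)
      have hs : IsSimpleModule R N := isSimpleModule_iff_isAtom.mpr hN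
      obtain ⟨I, hI, ⟨e⟩⟩ := isSimpleModule_iff_quot_maximal.mp hs
      have hIe : I = NU h := by
        refine hI.eq_of_le ?_ ?_
        · intro ht
          have : (1 : R) ∈ NU h := by rw [ht]; trivial
          exact this isUnit_one
        · intro x hx hu
          exact hI.ne_top (Ideal.eq_top_of_isUnit_mem _ hx hu)
      have hc : Nat.card N = rc h := by
        rw [Nat.card_congr e.toEquiv, hIe, rc]
      have hM := Submodule.card_eq_card_quotient_mul_card N
      have h2 := two_le_rc h
      have : Finite (M ⧸ N) := Finite.of_surjective _ (Submodule.mkQ_surjective _)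
      have hpos : 0 < Nat.card (M ⧸ N) := Nat.card_pos
      obtain ⟨m, hm⟩ := ih (Nat.card (M ⧸ N)) (by rw [← hn, hM, hc]; nlinarith) (M ⧸ N) rfl
      exact ⟨m + 1, by rw [hM, hc, hm, pow_succ, mul_comm]⟩

theorem index_eq {S : Type*} {E : Type w} [Ring S] [Finite S] [Ring E] [Finite E]
    (hS : TI S) (hE : TI E) (φ : S →+* E) :
    ∃ a b c, 0 < c ∧ rc hE = rc hS ^ c ∧
      (Units.map (φ : S →* E)).range.index * (rc hS ^ a * (rc hS - 1)) =
        rc hS ^ b * (rc hE - 1) := by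
  let _ : Module S E := Module.compHom E φ
  have hsm : ∀ (s : S) (x : E), s • x = φ s * x := fun _ _ => rfl
  let J : Submodule S E :=
    { carrier := {x | ¬ IsUnit x}
      zero_mem' := (NU hE).zero_mem
      add_mem' := fun {a b} ha hb => (NU hE).add_mem (show a ∈ NU hE from ha) (show b ∈ NU hE from hb)
      smul_mem' := fun s x hx => (NU hE).smul_mem (φ s) (show x ∈ NU hE from hx) }
  have hJ : Nat.card J = Nat.card (NU hE) := rfl
  obtain ⟨e, he⟩ := card_module hS _ E rfl
  obtain ⟨μ, hμ⟩ := card_module hS _ J rfl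
  obtain ⟨s, hs⟩ := card_module hS _ (NU hS) rfl
  obtain ⟨t, ht⟩ := card_module hS _ (RingHom.ker φ) rfl
  have : Finite (E ⧸ J) := Finite.of_surjective _ (Submodule.mkQ_surjective _)
  obtain ⟨c, hc⟩ := card_module hS _ (E ⧸ J) rfl
  have hrc : rc hE = rc hS ^ c := by
    have h1 := rc_mul hE
    rw [← hJ, Submodule.card_eq_card_quotient_mul_card J, hc, mul_comm] at h1
    exact (Nat.eq_of_mul_eq_mul_right Nat.card_pos h1).symm
  have hc0 : 0 < c := by
    rcases Nat.eq_zero_or_pos c with h0 | h0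
    · have := two_le_rc hE
      rw [hrc, h0] at this
      simp at this
    · exact h0
  refine ⟨s, μ + t, c, hc0, hrc, ?_⟩
  have hker : Nat.card (Units.map (φ : S →* E)).ker = rc hS ^ t := by
    rw [← ht]
    refine Nat.card_congr
      { toFun := fun u => ⟨(u.1 : S) - 1, ?_⟩
        invFun := fun x => ⟨(show IsUnit ((x : S) + 1) from ?_).unit, ?_⟩
        left_inv := ?_
        right_inv := ?_ }
    · have := u.2
      rw [MonoidHom.mem_ker, Units.ext_iff] at this
      rw [RingHom.mem_ker, map_sub, map_one, sub_eq_zero]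
      exact this
    · have hx : φ x = 0 := x.2
      have : IsNilpotent (x : S) := by
        apply hS.nil_of_not_unit
        intro hu
        have := hu.map φ
        rw [hx] at this
        exact hE.not_unit_of_nil IsNilpotent.zero this
      exact this.isUnit_add_one
    · have hx : φ x = 0 := x.2
      rw [MonoidHom.mem_ker, Units.ext_iff]
      simp [hx]
    · intro u
      apply Subtype.ext
      apply Units.ext
      simp
    · intro x
      apply Subtype.ext
      simp
  have h1 := Subgroup.index_mul_card (Units.map (φ : S →* E)).range
  have h2 : Nat.card Sˣ = Nat.card (Units.map (φ : S →* E)).range * Nat.card (Units.map (φ : S →* E)).ker := by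
    rw [Subgroup.card_eq_card_quotient_mul_card_subgroup (Units.map (φ : S →* E)).ker]
    rw [Nat.card_congr (QuotientGroup.quotientKerEquivRange (Units.map (φ : S →* E))).toEquiv]
  rw [card_units hS, hs, hker] at h2
  rw [card_units hE, ← hJ, hμ] at h1
  rw [mul_comm (rc hS ^ s), h2, ← mul_assoc, h1, pow_add]
  ring

theorem geom_cong (x : ℤ) (n : ℕ) : ∃ y, x ^ n - 1 = (x - 1) * (n + (x - 1) * y) := by
  induction n with
  | zero => exact ⟨0, by simp⟩
  | succ n ih =>
    obtain ⟨y, hy⟩ := ih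
    refine ⟨n + (x - 1) * y + y, ?_⟩
    have : x ^ (n + 1) - 1 = x * (x ^ n - 1) + (x - 1) := by ring
    rw [this, hy]; push_cast; ring

theorem num_lemma (q Q a b c c' r s r' s' N N' : ℕ) (hq : 2 ≤ q) (hQ : 2 ≤ Q)
    (hc : 0 < c) (hc' : 0 < c')
    (h1 : q ^ a = Q ^ c) (h2 : q ^ b = Q ^ c')
    (e1 : N * (Q ^ r * (Q - 1)) = Q ^ s * (q ^ a - 1))
    (e2 : N' * (Q ^ r' * (Q - 1)) = Q ^ s' * (q ^ b - 1)) :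
    ((q : ℤ) - 1) ∣ (b : ℤ) * N - a * N' := by
  have red : ∀ (N a c r s : ℕ), 0 < c → q ^ a = Q ^ c →
      N * (Q ^ r * (Q - 1)) = Q ^ s * (q ^ a - 1) →
      ((q : ℤ) - 1) * (Q - 1) ∣ (N : ℤ) * (Q - 1) - (q ^ a - 1) := by
    intro N a c r s hc h1 e1
    have hd : Q ^ r ∣ Q ^ s := by
      have hcop : Nat.Coprime (Q ^ r) (q ^ a - 1) := by
        apply Nat.Coprime.pow_left
        rw [h1]
        obtain ⟨c, rfl⟩ : ∃ d, c = d + 1 := ⟨c - 1, by omega⟩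
        have h3 : 1 ≤ Q ^ (c + 1) := Nat.one_le_pow _ _ (by omega)
        have h4 : Nat.Coprime (Q ^ (c+1)) (Q ^ (c + 1) - 1) := by
          have := (Nat.coprime_self_add_left (m := Q ^ (c + 1) - 1) (n := 1)).mpr (by simp)
          rwa [Nat.sub_add_cancel h3] at this
        exact Nat.Coprime.coprime_dvd_left (dvd_pow_self Q (by omega)) h4
      apply hcop.dvd_of_dvd_mul_right
      rw [← e1]
      exact (Dvd.intro _ rfl).mul_left _
    have hrs : r ≤ s := (Nat.pow_dvd_pow_iff_le_right (by omega)).mp hd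
    obtain ⟨t, rfl⟩ := Nat.exists_eq_add_of_le hrs
    have e : N * (Q - 1) = Q ^ t * (q ^ a - 1) := by
      have hp : 0 < Q ^ r := by positivity
      apply Nat.eq_of_mul_eq_mul_left hp
      rw [pow_add] at e1
      linarith
    have hqa : 1 ≤ q ^ a := Nat.one_le_pow _ _ (by omega)
    zify [show 1 ≤ Q by omega, hqa] at e
    rw [e]
    have : (Q : ℤ) ^ t * (q ^ a - 1) - (q ^ a - 1) = (q ^ a - 1) * (Q ^ t - 1) := by ring
    rw [this]
    exact mul_dvd_mul (sub_one_dvd_pow_sub_one _ _) (sub_one_dvd_pow_sub_one _ _)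
  have d1 := red N a c r s hc h1 e1
  have d2 := red N' b c' r' s' hc' h2 e2
  have hg : (Q : ℤ) - 1 ∣ (q : ℤ) ^ (Nat.gcd a b) - 1 := by
    have h3 : Q - 1 ∣ q ^ Nat.gcd a b - 1 := by
      rw [← Nat.pow_sub_one_gcd_pow_sub_one]
      apply Nat.dvd_gcd
      · rw [h1]; exact Nat.sub_one_dvd_pow_sub_one _ _
      · rw [h2]; exact Nat.sub_one_dvd_pow_sub_one _ _
    have := Int.natCast_dvd_natCast.mpr h3
    rwa [Nat.cast_sub (by omega), Nat.cast_sub (Nat.one_le_pow _ _ (by omega)), Nat.cast_pow,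
      Nat.cast_one] at this
  have d3 : ((q : ℤ) - 1) * (Q - 1) ∣ (b : ℤ) * (q ^ a - 1) - a * (q ^ b - 1) := by
    set g := Nat.gcd a b with hgdef
    obtain ⟨a', ha'⟩ : g ∣ a := Nat.gcd_dvd_left _ _
    obtain ⟨b', hb'⟩ : g ∣ b := Nat.gcd_dvd_right _ _
    obtain ⟨y, hy⟩ := geom_cong ((q : ℤ) ^ g) a'
    obtain ⟨z, hz⟩ := geom_cong ((q : ℤ) ^ g) b'
    have : (b : ℤ) * (q ^ a - 1) - a * (q ^ b - 1) =
        (((q : ℤ) ^ g - 1) * (q ^ g - 1)) * (g * (b' * y - a' * z)) := by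
      have ea : (q : ℤ) ^ a = (q ^ g) ^ a' := by rw [← pow_mul, ← ha']
      have eb : (q : ℤ) ^ b = (q ^ g) ^ b' := by rw [← pow_mul, ← hb']
      have ca : (a : ℤ) = g * a' := by exact_mod_cast ha'
      have cb : (b : ℤ) = g * b' := by exact_mod_cast hb'
      rw [ea, eb, hy, hz, ca, cb]
      ring
    rw [this]
    exact Dvd.dvd.mul_right (mul_dvd_mul (sub_one_dvd_pow_sub_one _ _) hg) _
  have hQ0 : (Q : ℤ) - 1 ≠ 0 := by
    have : (2 : ℤ) ≤ Q := by exact_mod_cast hQ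
    linarith
  apply Int.dvd_of_mul_dvd_mul_right hQ0
  have : ((b : ℤ) * N - a * N') * (Q - 1) =
      b * (N * (Q - 1) - (q ^ a - 1)) - a * (N' * (Q - 1) - (q ^ b - 1)) +
        (b * (q ^ a - 1) - a * (q ^ b - 1)) := by ring
  rw [this]
  exact dvd_add (dvd_sub (d1.mul_left _) (d2.mul_left _)) d3

theorem rc_eq_pow_dk (k : Type) [Field k] [Fintype k] {A : Type w} [Ring A] [Algebra k A]
    [Finite A] (h : TI A) : rc h = Fintype.card k ^ dk k A := by
  have hmem : ∀ x : A, x ∈ radSubmodule k A ↔ ¬ IsUnit x := by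
    intro x
    change x ∈ TwoSidedIdeal.jacobson (⊥ : TwoSidedIdeal A) ↔ _
    rw [TwoSidedIdeal.mem_jacobson_iff]
    constructor
    · rintro hx ⟨u, rfl⟩
      obtain ⟨z, hz⟩ := hx (-↑u⁻¹)
      rw [TwoSidedIdeal.mem_bot] at hz
      apply h.1
      rw [mul_assoc, neg_mul, Units.inv_mul] at hz
      have hz' : z * -1 + z - 1 = -1 := by noncomm_ring
      rw [hz'] at hz
      exact (neg_eq_zero.mp hz).symm
    · intro hx y
      have hyx : ¬ IsUnit (y * x) := fun h' => hx (unit_of_mul_left h')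
      obtain ⟨u, hu⟩ := (h.nil_of_not_unit hyx).isUnit_add_one
      refine ⟨↑u⁻¹, ?_⟩
      rw [TwoSidedIdeal.mem_bot]
      have : (↑u⁻¹ : A) * (y * x + 1) = 1 := by rw [← hu]; simp
      rw [← this]; noncomm_ring
  have hcard : Nat.card (radSubmodule k A) = Nat.card (NU h) :=
    Nat.card_congr (Equiv.subtypeEquivRight hmem)
  have h1 := Submodule.card_eq_card_quotient_mul_card (radSubmodule k A)
  have h2 : Nat.card (A ⧸ radSubmodule k A) = Fintype.card k ^ dk k A := by
    rw [Module.natCard_eq_pow_finrank (K := k), Nat.card_eq_fintype_card]; rfl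
  rw [h2, hcard, rc_mul h, mul_comm] at h1
  exact Nat.eq_of_mul_eq_mul_left Nat.card_pos h1

theorem TI.of_equiv {R R' : Type*} [Ring R] [Ring R'] (e : R ≃+* R') (h : TI R) : TI R' := by
  refine ⟨fun h0 => h.1 (e.injective (by simpa using h0)), fun x hx => ?_⟩
  rcases h.2 (e.symm x) (by rw [← map_mul, hx]) with h0 | h0
  · left; simpa using h0
  · right; simpa using h0

theorem rc_congr {R R' : Type*} [Ring R] [Ring R'] [Finite R] [Finite R'] (e : R ≃+* R')
    (h : TI R) (h' : TI R') : rc h = rc h' := by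
  have h1 : Nat.card R = Nat.card R' := Nat.card_congr e.toEquiv
  have h2 : Nat.card (NU h) = Nat.card (NU h') :=
    Nat.card_congr (e.toEquiv.subtypeEquiv (fun x => by
      change ¬ IsUnit x ↔ ¬ IsUnit (e x)
      rw [MulEquiv.isUnit_map]))
  rw [rc_mul h, rc_mul h', h2] at h1
  exact Nat.eq_of_mul_eq_mul_right Nat.card_pos h1

theorem orbit_count {G W U : Type*} [Group G] [MulAction G W] [Finite W] [Group U]
    [Fintype (MulAction.orbitRel.Quotient G W)]
    (pr : G →* U) (hpr : Function.Surjective pr) (R : W → W → Prop)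
    (hR : ∀ p q, R p q ↔ ∃ g, pr g = 1 ∧ g • p = q) :
    Nat.card (Quot R) = ∑ O : MulAction.orbitRel.Quotient G W,
      (Subgroup.map pr (MulAction.stabilizer G O.out)).index := by
  have hequiv : Equivalence R := by
    refine ⟨fun p => (hR _ _).mpr ⟨1, map_one _, one_smul _ _⟩, fun {p q} h => ?_, fun {p q r} h h' => ?_⟩
    · obtain ⟨g, hg, rfl⟩ := (hR _ _).mp h
      exact (hR _ _).mpr ⟨g⁻¹, by simp [hg], by simp⟩
    · obtain ⟨g, hg, rfl⟩ := (hR _ _).mp h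
      obtain ⟨g', hg', rfl⟩ := (hR _ _).mp h'
      exact (hR _ _).mpr ⟨g' * g, by simp [hg, hg'], by rw [mul_smul]⟩
  have hsound : ∀ p q, Quot.mk R p = Quot.mk R q ↔ R p q := fun p q =>
    ⟨fun h => (hequiv.eqvGen_iff).mp (Quot.eqvGen_exact h), fun h => Quot.sound h⟩
  let π : Quot R → MulAction.orbitRel.Quotient G W :=
    Quot.lift (fun w => Quotient.mk _ w) (by
      intro p q h
      obtain ⟨g, hg, rfl⟩ := (hR _ _).mp h
      apply Quotient.sound
      exact ⟨g⁻¹, by simp⟩)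
  rw [Nat.card_congr (Equiv.sigmaFiberEquiv π).symm, Nat.card_sigma]
  refine Finset.sum_congr rfl fun O _ => ?_
  set w := O.out with hw
  have hO : Quotient.mk _ w = O := Quotient.out_eq O
  rw [Subgroup.index]
  symm
  choose ι hι using hpr
  have key : ∀ g g' : G, R (g • w) (g' • w) ↔
      (pr g)⁻¹ * pr g' ∈ Subgroup.map pr (MulAction.stabilizer G w) := by
    intro g g'
    rw [hR, Subgroup.mem_map]
    constructor
    · rintro ⟨x, hx, h⟩
      refine ⟨(g'⁻¹ * x * g)⁻¹, (MulAction.stabilizer G w).inv_mem ?_, ?_⟩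
      · change (g'⁻¹ * x * g) • w = w
        rw [mul_smul, mul_smul, h, inv_smul_smul]
      · simp [hx]
    · rintro ⟨s, hs, h⟩
      refine ⟨g' * s⁻¹ * g⁻¹, ?_, ?_⟩
      · simp [h]
      · rw [mul_smul, mul_smul, inv_smul_smul]
        have : s⁻¹ • w = w := (MulAction.stabilizer G w).inv_mem hs
        rw [this]
  refine Nat.card_congr (Equiv.ofBijective
    (Quotient.lift (fun u => (⟨Quot.mk R (ι u • w), ?_⟩ : {c // π c = O})) ?_) ⟨?_, ?_⟩)
  · rw [← hO]
    exact Quotient.sound ⟨ι u, rfl⟩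
  · intro u u' h
    apply Subtype.ext
    rw [hsound, key, hι, hι]
    exact QuotientGroup.leftRel_apply.mp h
  · rintro ⟨u⟩ ⟨u'⟩ h
    have h := congrArg Subtype.val h
    have h := (hsound _ _).mp h
    rw [key, hι, hι] at h
    exact Quotient.sound (QuotientGroup.leftRel_apply.mpr h)
  · rintro ⟨⟨p⟩, hp⟩
    have hp' : (Quotient.mk _ p : MulAction.orbitRel.Quotient G W) = Quotient.mk _ w := by
      rw [hO]; exact hp
    obtain ⟨g, hg⟩ := Quotient.exact hp'
    refine ⟨Quotient.mk _ (pr g), Subtype.ext ?_⟩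
    change Quot.mk R (ι (pr g) • w) = Quot.mk R p
    rw [hsound]
    have hg : g • w = p := hg
    rw [← hg, key, hι]
    simp

end Algebra

section Cat

set_option linter.unusedSectionVars false

theorem TI_of_indec (X : C) (hX : Indecomposable X) : TI (End X) := by
  refine ⟨fun h => hX.1 ?_, fun (e : X ⟶ X) he => ?_⟩
  · rw [IsZero.iff_id_eq_zero]
    exact h.symm
  · have he' : e ≫ e = e := he
    obtain ⟨A, i, p, h1, h2⟩ := IsIdempotentComplete.idempotents_split X e he'
    obtain ⟨B, j, r, h3, h4⟩ := IsIdempotentComplete.idempotents_split X (𝟙 X - e)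
      (Idempotents.idem_of_id_sub_idem e he')
    have hir : i ≫ r = 0 := by
      have : i ≫ r = (i ≫ p) ≫ i ≫ r ≫ (j ≫ r) := by simp [h1, h3]
      rw [this]
      have : (i ≫ p) ≫ i ≫ r ≫ j ≫ r = i ≫ ((p ≫ i) ≫ (r ≫ j)) ≫ r := by simp
      rw [this, h2, h4]
      simp [Preadditive.comp_sub, he']
    have hjp : j ≫ p = 0 := by
      have : j ≫ p = (j ≫ r) ≫ j ≫ p ≫ (i ≫ p) := by simp [h1, h3]
      rw [this]
      have : (j ≫ r) ≫ j ≫ p ≫ (i ≫ p) = j ≫ ((r ≫ j) ≫ (p ≫ i)) ≫ p := by simp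
      rw [this, h2, h4]
      simp [Preadditive.sub_comp, he']
    let iso : X ≅ A ⊞ B :=
      { hom := biprod.lift p r
        inv := biprod.desc i j
        hom_inv_id := by rw [biprod.lift_desc, h2, h4]; abel
        inv_hom_id := by
          apply biprod.hom_ext' <;> apply biprod.hom_ext <;> simp [h1, h3, hir, hjp] }
    rcases hX.2 A B iso with hA | hB
    · left
      change e = (0 : X ⟶ X)
      rw [← h2, hA.eq_of_tgt p 0, zero_comp]
    · right
      change e = 𝟙 X
      have : 𝟙 X - e = 0 := by rw [← h4, hB.eq_of_tgt r 0, zero_comp]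
      exact (sub_eq_zero.mp this).symm

theorem TI.id_ne {X : C} (h : TI (End X)) : 𝟙 X ≠ 0 := fun h' => h.1 h'.symm

/-- The shift functor induces a ring isomorphism on endomorphism rings. -/
noncomputable def endShift (X : C) : End X ≃+* End (X⟦(1 : ℤ)⟧) :=
  { (Functor.FullyFaithful.ofFullyFaithful (shiftFunctor C (1 : ℤ))).homEquiv (X := X) (Y := X) with
    map_mul' := fun a b => (shiftFunctor C (1 : ℤ)).map_comp b a
    map_add' := fun a b => (shiftFunctor C (1 : ℤ)).map_add }

theorem mor₁_ne_zero (T : Triangle C) (hT : T ∈ distTriang C) (h1 : TI (End T.obj₁))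
    (h2 : TI (End T.obj₂)) (h3 : TI (End T.obj₃)) : T.mor₁ ≠ 0 := by
  intro h0
  obtain ⟨r, hr⟩ := T.yoneda_exact₂ hT (𝟙 _) (by rw [h0, zero_comp])
  have hid : (r ≫ T.mor₂) ≫ (r ≫ T.mor₂) = r ≫ T.mor₂ := by
    rw [Category.assoc, ← Category.assoc T.mor₂, ← hr, Category.id_comp]
  rcases h3.2 (r ≫ T.mor₂) hid with h | h
  · apply h2.id_ne
    have h : r ≫ T.mor₂ = 0 := h
    have : 𝟙 T.obj₂ = (T.mor₂ ≫ r) ≫ (T.mor₂ ≫ r) := by rw [← hr, Category.id_comp]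
    rw [this, Category.assoc, ← Category.assoc r, h, zero_comp, comp_zero]
  · have h : r ≫ T.mor₂ = 𝟙 _ := h
    have hiso : IsIso T.mor₂ := ⟨r, hr.symm, h⟩
    exact h1.id_ne ((T.isZero₁_of_isIso₂ hT hiso).eq_of_src _ _)

theorem WT_nonzero {X Y L : C} (hX : TI (End X)) (hY : TI (End Y)) (hL : TI (End L))
    (w : WT X Y L) : w.1.1 ≠ 0 ∧ w.1.2.1 ≠ 0 ∧ w.1.2.2 ≠ 0 := by
  have h1 := w.2
  have h2 := rot_of_distTriang _ h1
  have h3 := rot_of_distTriang _ h2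
  exact ⟨mor₁_ne_zero _ h1 hY hL hX,
    mor₁_ne_zero _ h2 hL hX (hY.of_equiv (endShift Y)),
    mor₁_ne_zero _ h3 hX (hY.of_equiv (endShift Y)) (hL.of_equiv (endShift L))⟩

/-- The endomorphism ring of a triangle. -/
def endTri {X Y L : C} (w : WT X Y L) : Subring (End X × End Y × End L) where
  carrier := {t | w.1.1 ≫ t.2.2 = t.2.1 ≫ w.1.1 ∧ w.1.2.1 ≫ t.1 = t.2.2 ≫ w.1.2.1 ∧
    w.1.2.2 ≫ (shiftFunctor C (1 : ℤ)).map t.2.1 = t.1 ≫ w.1.2.2}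
  one_mem' := by
    refine ⟨?_, ?_, ?_⟩
    · exact (Category.comp_id _).trans (Category.id_comp _).symm
    · exact (Category.comp_id _).trans (Category.id_comp _).symm
    · change w.1.2.2 ≫ (shiftFunctor C (1 : ℤ)).map (𝟙 Y) = 𝟙 X ≫ w.1.2.2
      simp
  zero_mem' := by
    refine ⟨?_, ?_, ?_⟩
    · exact comp_zero.trans zero_comp.symm
    · exact comp_zero.trans zero_comp.symm
    · change w.1.2.2 ≫ (shiftFunctor C (1 : ℤ)).map (0 : Y ⟶ Y) = (0 : X ⟶ X) ≫ w.1.2.2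
      simp
  mul_mem' := by
    rintro ⟨a, b, c⟩ ⟨a', b', c'⟩ ⟨h1, h2, h3⟩ ⟨h1', h2', h3'⟩
    dsimp only at h1 h2 h3 h1' h2' h3'
    refine ⟨?_, ?_, ?_⟩
    · change w.1.1 ≫ c' ≫ c = (b' ≫ b) ≫ w.1.1
      rw [reassoc_of% h1', h1, Category.assoc]
    · change w.1.2.1 ≫ a' ≫ a = (c' ≫ c) ≫ w.1.2.1
      rw [reassoc_of% h2', h2, Category.assoc]
    · change w.1.2.2 ≫ (shiftFunctor C (1 : ℤ)).map (b' ≫ b) = (a' ≫ a) ≫ w.1.2.2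
      rw [Functor.map_comp, reassoc_of% h3', h3, Category.assoc]
  add_mem' := by
    rintro ⟨a, b, c⟩ ⟨a', b', c'⟩ ⟨h1, h2, h3⟩ ⟨h1', h2', h3'⟩
    dsimp only at h1 h2 h3 h1' h2' h3'
    refine ⟨?_, ?_, ?_⟩
    · change w.1.1 ≫ (c + c' : L ⟶ L) = (b + b' : Y ⟶ Y) ≫ w.1.1
      rw [Preadditive.comp_add, Preadditive.add_comp, h1, h1']
    · change w.1.2.1 ≫ (a + a' : X ⟶ X) = (c + c' : L ⟶ L) ≫ w.1.2.1
      rw [Preadditive.comp_add, Preadditive.add_comp, h2, h2']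
    · change w.1.2.2 ≫ (shiftFunctor C (1 : ℤ)).map (b + b' : Y ⟶ Y) = (a + a' : X ⟶ X) ≫ w.1.2.2
      rw [Functor.map_add, Preadditive.comp_add, Preadditive.add_comp, h3, h3']
  neg_mem' := by
    rintro ⟨a, b, c⟩ ⟨h1, h2, h3⟩
    dsimp only at h1 h2 h3
    refine ⟨?_, ?_, ?_⟩
    · change w.1.1 ≫ (-c : L ⟶ L) = (-b : Y ⟶ Y) ≫ w.1.1
      rw [Preadditive.comp_neg, Preadditive.neg_comp, h1]
    · change w.1.2.1 ≫ (-a : X ⟶ X) = (-c : L ⟶ L) ≫ w.1.2.1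
      rw [Preadditive.comp_neg, Preadditive.neg_comp, h2]
    · change w.1.2.2 ≫ (shiftFunctor C (1 : ℤ)).map (-b : Y ⟶ Y) = (-a : X ⟶ X) ≫ w.1.2.2
      rw [Functor.map_neg, Preadditive.comp_neg, Preadditive.neg_comp, h3]

theorem TI_endTri {X Y L : C} (hX : TI (End X)) (hY : TI (End Y)) (hL : TI (End L))
    (w : WT X Y L) : TI (endTri w) := by
  obtain ⟨n1, n2, n3⟩ := WT_nonzero hX hY hL w
  refine ⟨fun h => hX.1 (congrArg (fun t => t.1.1) h), ?_⟩
  rintro ⟨⟨a, b, c⟩, h1, h2, h3⟩ hi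
  have hi' := congrArg Subtype.val hi
  have ha : a * a = a := congrArg (fun t => t.1) hi'
  have hb : b * b = b := congrArg (fun t => t.2.1) hi'
  have hc : c * c = c := congrArg (fun t => t.2.2) hi'
  dsimp only at h1 h2 h3
  have i1 : ∀ {A B : C} (f : A ⟶ B), f ≫ (1 : End B) = f := fun f => Category.comp_id f
  have i2 : ∀ {A B : C} (f : A ⟶ B), (1 : End A) ≫ f = f := fun f => Category.id_comp f
  have z1 : ∀ {A B : C} (f : A ⟶ B), f ≫ (0 : End B) = 0 := fun f => comp_zero
  have z2 : ∀ {A B : C} (f : A ⟶ B), (0 : End A) ≫ f = 0 := fun f => zero_comp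
  rcases hL.2 c hc with rfl | rfl
  · rcases hY.2 b hb with rfl | rfl
    · rcases hX.2 a ha with rfl | rfl
      · exact Or.inl rfl
      · rw [i1, z2] at h2; exact absurd h2 n2
    · rw [z1, i2] at h1; exact absurd h1.symm n1
  · rcases hY.2 b hb with rfl | rfl
    · rw [i1, z2] at h1; exact absurd h1 n1
    · rcases hX.2 a ha with rfl | rfl
      · rw [z1, i2] at h2; exact absurd h2.symm n2
      · exact Or.inr rfl

@[simp] theorem aut_one_hom (X : C) : (1 : Aut X).hom = 𝟙 X := rfl
@[simp] theorem aut_one_inv (X : C) : (1 : Aut X).inv = 𝟙 X := rfl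
@[simp] theorem aut_mul_hom (X : C) (a b : Aut X) : (a * b).hom = b.hom ≫ a.hom := rfl
@[simp] theorem aut_mul_inv (X : C) (a b : Aut X) : (a * b).inv = a.inv ≫ b.inv := rfl

/-- Action of the full automorphism group. -/
instance actWT (X Y L : C) : MulAction (Aut X × Aut Y × Aut L) (WT X Y L) where
  smul g w := ⟨(g.2.1.inv ≫ w.1.1 ≫ g.2.2.hom, g.2.2.inv ≫ w.1.2.1 ≫ g.1.hom,
    g.1.inv ≫ w.1.2.2 ≫ (shiftFunctor C (1 : ℤ)).map g.2.1.hom), by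
      let ξ : X ≅ X := g.1
      let η : Y ≅ Y := g.2.1
      let l : L ≅ L := g.2.2
      change Triangle.mk (η.inv ≫ w.1.1 ≫ l.hom) (l.inv ≫ w.1.2.1 ≫ ξ.hom)
        (ξ.inv ≫ w.1.2.2 ≫ (shiftFunctor C (1 : ℤ)).map η.hom) ∈ _
      refine (distinguished_iff_of_iso (Triangle.isoMk
        (Triangle.mk w.1.1 w.1.2.1 w.1.2.2) (Triangle.mk _ _ _) η l ξ ?_ ?_ ?_)).mp w.2
      · exact ((Iso.hom_inv_id_assoc η _)).symm
      · exact ((Iso.hom_inv_id_assoc l _)).symm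
      · exact ((Iso.hom_inv_id_assoc ξ _)).symm⟩
  one_smul w := by
    apply Subtype.ext
    refine Prod.ext ?_ (Prod.ext ?_ ?_)
    · change 𝟙 Y ≫ w.1.1 ≫ 𝟙 L = _
      simp
    · change 𝟙 L ≫ w.1.2.1 ≫ 𝟙 X = _
      simp
    · change 𝟙 X ≫ w.1.2.2 ≫ (shiftFunctor C (1 : ℤ)).map (𝟙 Y) = _
      simp
  mul_smul g g' w := by
    apply Subtype.ext
    refine Prod.ext ?_ (Prod.ext ?_ ?_)
    · change (g.2.1.inv ≫ g'.2.1.inv) ≫ w.1.1 ≫ g'.2.2.hom ≫ g.2.2.hom =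
        g.2.1.inv ≫ (g'.2.1.inv ≫ w.1.1 ≫ g'.2.2.hom) ≫ g.2.2.hom
      simp
    · change (g.2.2.inv ≫ g'.2.2.inv) ≫ w.1.2.1 ≫ g'.1.hom ≫ g.1.hom =
        g.2.2.inv ≫ (g'.2.2.inv ≫ w.1.2.1 ≫ g'.1.hom) ≫ g.1.hom
      simp
    · change (g.1.inv ≫ g'.1.inv) ≫ w.1.2.2 ≫
          (shiftFunctor C (1 : ℤ)).map (g'.2.1.hom ≫ g.2.1.hom) =
        g.1.inv ≫ (g'.1.inv ≫ w.1.2.2 ≫ (shiftFunctor C (1 : ℤ)).map g'.2.1.hom) ≫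
          (shiftFunctor C (1 : ℤ)).map g.2.1.hom
      simp

theorem smul_eq_iff {X Y L : C} (g : Aut X × Aut Y × Aut L) (p q : WT X Y L) :
    g • p = q ↔ q.1.1 = g.2.1.inv ≫ p.1.1 ≫ g.2.2.hom ∧
      q.1.2.1 = g.2.2.inv ≫ p.1.2.1 ≫ g.1.hom ∧
      q.1.2.2 = g.1.inv ≫ p.1.2.2 ≫ (shiftFunctor C (1 : ℤ)).map g.2.1.hom := by
  constructor
  · rintro rfl
    exact ⟨rfl, rfl, rfl⟩
  · rintro ⟨h1, h2, h3⟩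
    exact Subtype.ext (Prod.ext h1.symm (Prod.ext h2.symm h3.symm))

theorem mem_stab_iff {X Y L : C} (g : Aut X × Aut Y × Aut L) (w : WT X Y L) :
    g ∈ MulAction.stabilizer _ w ↔
      ((g.1.hom, g.2.1.hom, g.2.2.hom) : End X × End Y × End L) ∈ endTri w := by
  rw [MulAction.mem_stabilizer_iff, smul_eq_iff]
  change _ ↔ w.1.1 ≫ g.2.2.hom = g.2.1.hom ≫ w.1.1 ∧ w.1.2.1 ≫ g.1.hom = g.2.2.hom ≫ w.1.2.1 ∧
    w.1.2.2 ≫ (shiftFunctor C (1 : ℤ)).map g.2.1.hom = g.1.hom ≫ w.1.2.2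
  have e1 := Iso.eq_inv_comp g.2.1 (f := w.1.1 ≫ g.2.2.hom) (g := w.1.1)
  have e2 := Iso.eq_inv_comp g.2.2 (f := w.1.2.1 ≫ g.1.hom) (g := w.1.2.1)
  have e3 := Iso.eq_inv_comp g.1 (f := w.1.2.2 ≫ (shiftFunctor C (1 : ℤ)).map g.2.1.hom)
    (g := w.1.2.2)
  rw [e1, e2, e3]
  constructor
  · rintro ⟨h1, h2, h3⟩
    exact ⟨h1.symm, h2.symm, h3.symm⟩
  · rintro ⟨h1, h2, h3⟩
    exact ⟨h1.symm, h2.symm, h3.symm⟩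

/-- units of the triangle endomorphism ring as automorphisms of the triangle -/
def unitsToAut {X Y L : C} (w : WT X Y L) (u : (endTri w)ˣ) : Aut X × Aut Y × Aut L :=
  (Aut.unitsEndEquivAut X (Units.map ((RingHom.fst _ _).comp (endTri w).subtype : _ →* End X) u),
   Aut.unitsEndEquivAut Y (Units.map (((RingHom.fst _ _).comp (RingHom.snd _ _)).comp
      (endTri w).subtype : _ →* End Y) u),
   Aut.unitsEndEquivAut L (Units.map (((RingHom.snd _ _).comp (RingHom.snd _ _)).comp
      (endTri w).subtype : _ →* End L) u))

theorem unitsToAut_mem {X Y L : C} (w : WT X Y L) (u : (endTri w)ˣ) :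
    unitsToAut w u ∈ MulAction.stabilizer _ w := by
  rw [mem_stab_iff]
  exact u.1.2

theorem exists_unit {X Y L : C} (w : WT X Y L) (g : Aut X × Aut Y × Aut L)
    (hg : g ∈ MulAction.stabilizer _ w) : ∃ u, unitsToAut w u = g := by
  have hg' := (MulAction.stabilizer _ w).inv_mem hg
  rw [mem_stab_iff] at hg hg'
  refine ⟨⟨⟨_, hg⟩, ⟨_, hg'⟩, ?_, ?_⟩, ?_⟩
  · apply Subtype.ext
    refine Prod.ext ?_ (Prod.ext ?_ ?_)
    · exact g.1.inv_hom_id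
    · exact g.2.1.inv_hom_id
    · exact g.2.2.inv_hom_id
  · apply Subtype.ext
    refine Prod.ext ?_ (Prod.ext ?_ ?_)
    · exact g.1.hom_inv_id
    · exact g.2.1.hom_inv_id
    · exact g.2.2.hom_inv_id
  · refine Prod.ext (Iso.ext rfl) (Prod.ext (Iso.ext rfl) (Iso.ext rfl))

theorem index_fst {X Y L : C} (w : WT X Y L) :
    (Subgroup.map (MonoidHom.fst (Aut X) (Aut Y × Aut L)) (MulAction.stabilizer _ w)).index =
      (Units.map ((RingHom.fst (End X) (End Y × End L)).comp (endTri w).subtype :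
        endTri w →* End X)).range.index := by
  rw [← Subgroup.index_map_equiv _ (Aut.unitsEndEquivAut X)]
  congr 1
  ext a
  simp only [Subgroup.mem_map, MonoidHom.mem_range]
  constructor
  · rintro ⟨g, hg, rfl⟩
    obtain ⟨u, rfl⟩ := exists_unit w g hg
    exact ⟨_, ⟨u, rfl⟩, rfl⟩
  · rintro ⟨_, ⟨u, rfl⟩, rfl⟩
    exact ⟨_, unitsToAut_mem w u, rfl⟩

theorem index_snd {X Y L : C} (w : WT X Y L) :
    (Subgroup.map ((MonoidHom.snd (Aut Y) (Aut L)).comp (MonoidHom.snd (Aut X) (Aut Y × Aut L)))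
      (MulAction.stabilizer _ w)).index =
      (Units.map (((RingHom.snd (End Y) (End L)).comp (RingHom.snd (End X) (End Y × End L))).comp
        (endTri w).subtype : endTri w →* End L)).range.index := by
  rw [← Subgroup.index_map_equiv _ (Aut.unitsEndEquivAut L)]
  congr 1
  ext a
  simp only [Subgroup.mem_map, MonoidHom.mem_range]
  constructor
  · rintro ⟨g, hg, rfl⟩
    obtain ⟨u, rfl⟩ := exists_unit w g hg
    exact ⟨_, ⟨u, rfl⟩, rfl⟩
  · rintro ⟨_, ⟨u, rfl⟩, rfl⟩
    exact ⟨_, unitsToAut_mem w u, rfl⟩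

/-- Orbit relation of `Aut Y × Aut L` on `WT X Y L`. -/
def WTRel' (X Y L : C) (p q : WT X Y L) : Prop :=
  ∃ (η : Aut Y) (l : Aut L),
    q.1.1 = η.inv ≫ p.1.1 ≫ l.hom ∧
    q.1.2.1 = l.inv ≫ p.1.2.1 ∧
    q.1.2.2 = p.1.2.2 ≫ (shiftFunctor C (1 : ℤ)).map η.hom

theorem WTRel_iff {X Y L : C} (p q : WT X Y L) : WTRel X Y L p q ↔
    ∃ g : Aut X × Aut Y × Aut L,
      ((MonoidHom.snd (Aut Y) (Aut L)).comp (MonoidHom.snd (Aut X) (Aut Y × Aut L))) g = 1 ∧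
      g • p = q := by
  constructor
  · rintro ⟨ξ, η, h1, h2, h3⟩
    refine ⟨(ξ, η, 1), rfl, (smul_eq_iff _ _ _).mpr ⟨?_, ?_, ?_⟩⟩
    · simpa using h1
    · simpa using h2
    · exact h3
  · rintro ⟨⟨ξ, η, l⟩, hl, h⟩
    obtain rfl : l = 1 := hl
    obtain ⟨h1, h2, h3⟩ := (smul_eq_iff _ _ _).mp h
    exact ⟨ξ, η, by simpa using h1, by simpa using h2, h3⟩

theorem WTRel'_iff {X Y L : C} (p q : WT X Y L) : WTRel' X Y L p q ↔
    ∃ g : Aut X × Aut Y × Aut L, MonoidHom.fst (Aut X) (Aut Y × Aut L) g = 1 ∧ g • p = q := by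
  constructor
  · rintro ⟨η, l, h1, h2, h3⟩
    refine ⟨(1, η, l), rfl, (smul_eq_iff _ _ _).mpr ⟨h1, ?_, ?_⟩⟩
    · simpa using h2
    · simpa using h3
  · rintro ⟨⟨ξ, η, l⟩, hl, h⟩
    obtain rfl : ξ = 1 := hl
    obtain ⟨h1, h2, h3⟩ := (smul_eq_iff _ _ _).mp h
    exact ⟨η, l, h1, by simpa using h2, by simpa using h3⟩

theorem main_cong (hHom : ∀ A B : C, Finite (A ⟶ B)) {X Y L : C}
    (hX : TI (End X)) (hY : TI (End Y)) (hL : TI (End L)) :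
    ((Fintype.card k : ℤ) - 1) ∣ (dk k (End X) : ℤ) * (FT X Y L : ℤ) -
      (dk k (End L) : ℤ) * (Nat.card (Quot (WTRel' X Y L)) : ℤ) := by
  have hEnd : ∀ A : C, Finite (End A) := fun A => hHom A A
  have hfin : Finite (WT X Y L) := by
    have := hHom
    unfold WT
    infer_instance
  have : Finite (MulAction.orbitRel.Quotient (Aut X × Aut Y × Aut L) (WT X Y L)) :=
    Quotient.finite _
  let _ : Fintype (MulAction.orbitRel.Quotient (Aut X × Aut Y × Aut L) (WT X Y L)) :=
    Fintype.ofFinite _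
  rw [FT, orbit_count _ (fun l => ⟨(1, 1, l), rfl⟩) _ (WTRel_iff (X := X) (Y := Y) (L := L)),
    orbit_count _ (fun l => ⟨(l, 1, 1), rfl⟩) _ (WTRel'_iff (X := X) (Y := Y) (L := L))]
  push_cast
  rw [Finset.mul_sum, Finset.mul_sum, ← Finset.sum_sub_distrib]
  refine Finset.dvd_sum fun O _ => ?_
  rw [index_fst, index_snd]
  generalize O.out = w
  have hS := TI_endTri hX hY hL w
  obtain ⟨a, b, c, hc, h1, h2⟩ := index_eq hS hL
    (((RingHom.snd (End Y) (End L)).comp (RingHom.snd (End X) (End Y × End L))).comp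
        (endTri w).subtype)
  obtain ⟨a', b', c', hc', h1', h2'⟩ := index_eq hS hX
    ((RingHom.fst (End X) (End Y × End L)).comp (endTri w).subtype)
  rw [rc_eq_pow_dk k hL] at h1 h2
  rw [rc_eq_pow_dk k hX] at h1' h2'
  exact num_lemma _ _ _ _ _ _ _ _ _ _ _ _ (Fintype.one_lt_card (α := k)) (two_le_rc hS)
    hc hc' h1 h1' h2 h2'

theorem dk_shift (hHom : ∀ A B : C, Finite (A ⟶ B)) {Z : C} (hZ : TI (End Z)) :
    dk k (End (Z⟦(1 : ℤ)⟧)) = dk k (End Z) := by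
  have hEnd : ∀ A : C, Finite (End A) := fun A => hHom A A
  have h := rc_congr (endShift Z) hZ (hZ.of_equiv (endShift Z))
  rw [rc_eq_pow_dk k, rc_eq_pow_dk k] at h
  exact (Nat.pow_right_injective (Fintype.one_lt_card (α := k)) h).symm

theorem dist_iff {X Y Z : C} (ε : (X⟦(1 : ℤ)⟧)⟦(1 : ℤ)⟧ ≅ X) (u : Z ⟶ X⟦(1 : ℤ)⟧)
    (v : X⟦(1 : ℤ)⟧ ⟶ Y) (f : Y ⟶ Z⟦(1 : ℤ)⟧) :
    Triangle.mk u v f ∈ distTriang C ↔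
      Triangle.mk f ((-(shiftFunctor C (1 : ℤ)).map u) ≫ ε.hom)
        (ε.inv ≫ (-(shiftFunctor C (1 : ℤ)).map v)) ∈ distTriang C := by
  rw [rotate_distinguished_triangle, rotate_distinguished_triangle]
  change Triangle.mk f (-(shiftFunctor C (1 : ℤ)).map u) (-(shiftFunctor C (1 : ℤ)).map v) ∈ _ ↔ _
  refine distinguished_iff_of_iso (Triangle.isoMk (Triangle.mk _ _ _) (Triangle.mk _ _ _)
    (Iso.refl Y) (Iso.refl (Z⟦(1 : ℤ)⟧)) ε ?_ ?_ ?_)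
  · exact (Category.comp_id f).trans (Category.id_comp f).symm
  · exact (Category.id_comp ((-(shiftFunctor C (1 : ℤ)).map u) ≫ ε.hom)).symm
  · change (-(shiftFunctor C (1 : ℤ)).map v) ≫ (shiftFunctor C (1 : ℤ)).map (𝟙 Y) =
      ε.hom ≫ ε.inv ≫ (-(shiftFunctor C (1 : ℤ)).map v)
    simp

/-- Rotation. -/
noncomputable def rotEquiv {X Y Z : C} (ε : (X⟦(1 : ℤ)⟧)⟦(1 : ℤ)⟧ ≅ X) :
    WT Y Z (X⟦(1 : ℤ)⟧) ≃ WT X Y (Z⟦(1 : ℤ)⟧) :=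
  Equiv.ofBijective (fun w => ⟨(w.1.2.2, (-(shiftFunctor C (1 : ℤ)).map w.1.1) ≫ ε.hom,
      ε.inv ≫ (-(shiftFunctor C (1 : ℤ)).map w.1.2.1)), (dist_iff ε _ _ _).mp w.2⟩) (by
    constructor
    · rintro ⟨⟨u, v, f⟩, h⟩ ⟨⟨u', v', f'⟩, h'⟩ e
      have e := congrArg Subtype.val e
      simp only [Prod.mk.injEq] at e
      obtain ⟨rfl, e1, e2⟩ := e
      rw [cancel_mono, neg_inj] at e1
      rw [cancel_epi, neg_inj] at e2
      obtain rfl := (shiftFunctor C (1 : ℤ)).map_injective e1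
      obtain rfl := (shiftFunctor C (1 : ℤ)).map_injective e2
      rfl
    · rintro ⟨⟨f, g, h⟩, hd⟩
      obtain ⟨u, hu⟩ := (shiftFunctor C (1 : ℤ)).map_surjective (-(g ≫ ε.inv))
      obtain ⟨v, hv⟩ := (shiftFunctor C (1 : ℤ)).map_surjective (-(ε.hom ≫ h))
      have e1 : (-(shiftFunctor C (1 : ℤ)).map u) ≫ ε.hom = g := by rw [hu]; simp
      have e2 : ε.inv ≫ (-(shiftFunctor C (1 : ℤ)).map v) = h := by rw [hv]; simp
      refine ⟨⟨(u, v, f), (dist_iff ε _ _ _).mpr ?_⟩, ?_⟩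
      · rw [e1, e2]; exact hd
      · apply Subtype.ext
        exact Prod.ext rfl (Prod.ext e1 e2))

theorem rot_card {X Y Z : C} (ε : (X⟦(1 : ℤ)⟧)⟦(1 : ℤ)⟧ ≅ X) :
    FT Y Z (X⟦(1 : ℤ)⟧) = Nat.card (Quot (WTRel' X Y (Z⟦(1 : ℤ)⟧))) := by
  refine Nat.card_congr (Quot.congr (rotEquiv ε) ?_)
  rintro ⟨⟨u, v, f⟩, h⟩ ⟨⟨u', v', f'⟩, h'⟩
  change (∃ (ξ : Y ≅ Y) (η : Z ≅ Z), u' = η.inv ≫ u ∧ v' = v ≫ ξ.hom ∧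
      f' = ξ.inv ≫ f ≫ (shiftFunctor C (1 : ℤ)).map η.hom) ↔
    ∃ (η : Y ≅ Y) (l : Z⟦(1 : ℤ)⟧ ≅ Z⟦(1 : ℤ)⟧),
      f' = η.inv ≫ f ≫ l.hom ∧
      (-(shiftFunctor C (1 : ℤ)).map u') ≫ ε.hom =
        l.inv ≫ ((-(shiftFunctor C (1 : ℤ)).map u) ≫ ε.hom) ∧
      ε.inv ≫ (-(shiftFunctor C (1 : ℤ)).map v') =
        (ε.inv ≫ (-(shiftFunctor C (1 : ℤ)).map v)) ≫ (shiftFunctor C (1 : ℤ)).map η.hom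
  constructor
  · rintro ⟨ξ, η, rfl, rfl, rfl⟩
    refine ⟨ξ, (shiftFunctor C (1 : ℤ)).mapIso η, ?_, ?_, ?_⟩ <;> simp
  · rintro ⟨η, l, h1, h2, h3⟩
    refine ⟨η, (shiftFunctor C (1 : ℤ)).preimageIso l, ?_, ?_, ?_⟩
    · apply (shiftFunctor C (1 : ℤ)).map_injective
      rw [← Category.assoc, cancel_mono, Preadditive.comp_neg, neg_inj] at h2
      rw [h2]
      simp
    · apply (shiftFunctor C (1 : ℤ)).map_injective
      rw [Category.assoc, cancel_epi, Preadditive.neg_comp, neg_inj] at h3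
      rw [h3]
      simp
    · rw [h1]
      simp

theorem half (hHom : ∀ A B : C, Finite (A ⟶ B))
    (per : Nonempty (shiftFunctor C (2 : ℤ) ≅ 𝟭 C))
    (X Y Z : C) (hX : Indecomposable X) (hY : Indecomposable Y)
    (hZ : Indecomposable Z) :
    ((Fintype.card k : ℤ) - 1) ∣
      (dk k (End X) : ℤ) * (FT X Y (Z⟦(1 : ℤ)⟧) : ℤ) -
        (dk k (End Z) : ℤ) * (FT Y Z (X⟦(1 : ℤ)⟧) : ℤ) := by
  obtain ⟨P⟩ := per
  have tX := TI_of_indec X hX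
  have tY := TI_of_indec Y hY
  have tZ := TI_of_indec Z hZ
  let ε : (X⟦(1 : ℤ)⟧)⟦(1 : ℤ)⟧ ≅ X :=
    ((shiftFunctorAdd' C (1 : ℤ) 1 2 (by norm_num)).app X).symm ≪≫ P.app X
  rw [rot_card ε, ← dk_shift k hHom tZ]
  exact main_cong k hHom tX tY (tZ.of_equiv (endShift Z))

end Cat

/-- Invariance of the symmetric bilinear form: if `C` is moreover 2-periodic, then for
all indecomposable `X, Y, Z`, `q - 1` divides
`d(X)·(F_{XY}^{TZ} - F_{YX}^{TZ}) - d(Z)·(F_{YZ}^{TX} - F_{ZY}^{TX})`. -/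
theorem form_invariance (hHom : ∀ A B : C, Finite (A ⟶ B))
    (per : Nonempty (shiftFunctor C (2 : ℤ) ≅ 𝟭 C))
    (X Y Z : C) (hX : Indecomposable X) (hY : Indecomposable Y)
    (hZ : Indecomposable Z) :
    ((Fintype.card k : ℤ) - 1) ∣
      (dk k (End X) : ℤ) * ((FT X Y (Z⟦(1 : ℤ)⟧) : ℤ) - (FT Y X (Z⟦(1 : ℤ)⟧) : ℤ)) -
        (dk k (End Z) : ℤ) * ((FT Y Z (X⟦(1 : ℤ)⟧) : ℤ) - (FT Z Y (X⟦(1 : ℤ)⟧) : ℤ)) := by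
  have h1 := half k hHom per X Y Z hX hY hZ
  have h2 := half k hHom per Z Y X hZ hY hX
  obtain ⟨c, hc⟩ := dvd_add h1 h2
  exact ⟨c, by linear_combination hc⟩

end HallTri
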